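/- Let F be a γ-pliable set family on a finite set V, let I be an inclusion-minimal cover of F such that every edge of I covers some F-core, let U be the union of all F-cores, let L be a laminar witness family for I augmented with V, let (S₀, S₁, …, S_ℓ) be a hollow chain in L with ℓ ∈ {2, 3}, and for each i let a_i b_i be the unique edge of I covering S_i with a_i ∈ S_i. Then at most 3 of the vertices in the list b₀, a₁, b₁, a₂, …, b_{ℓ−1}, a_ℓ (that is, all a_i with 1 ≤ i ≤ ℓ together with all b_i with 0 ≤ i ≤ ℓ−1) belong to U. -/

import Mathlib

open scoped Classical

namespace SFEC

variable {V : Type*}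

/-- An edge (an unordered pair of distinct elements) `e` covers a set `S`
if exactly one endpoint of `e` lies in `S`. -/
def Covers (e : Sym2 V) (S : Set V) : Prop :=
  ∃ u v : V, e = s(u, v) ∧ u ∈ S ∧ v ∉ S

/-- `delta I S` is the set of edges of `I` with exactly one endpoint in `S`. -/
noncomputable def delta (I : Finset (Sym2 V)) (S : Set V) : Finset (Sym2 V) :=
  I.filter (fun e => Covers e S)

/-- `d I S = |delta I S|`. -/
noncomputable def d (I : Finset (Sym2 V)) (S : Set V) : ℕ := (delta I S).card

/-- A set family on `V`: a collection of subsets with `∅ ∉ F` and `V ∉ F`. -/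
def IsSetFamily (F : Set (Set V)) : Prop := ∅ ∉ F ∧ Set.univ ∉ F

/-- `I` covers the family `F` if it covers every member of `F`. -/
def CoversFam (I : Finset (Sym2 V)) (F : Set (Set V)) : Prop := ∀ S ∈ F, 1 ≤ d I S

/-- `I` is an inclusion-minimal cover of `F`. -/
def MinimalCover (I : Finset (Sym2 V)) (F : Set (Set V)) : Prop :=
  CoversFam I F ∧ ∀ J : Finset (Sym2 V), J ⊂ I → ¬ CoversFam J F

/-- At least two of the four statements hold. -/
def AtLeastTwo (p q r s : Prop) : Prop :=
  (p ∧ q) ∨ (p ∧ r) ∨ (p ∧ s) ∨ (q ∧ r) ∨ (q ∧ s) ∨ (r ∧ s)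

/-- A family is pliable if for all `A, B ∈ F` at least two of the four sets
`A ∩ B, A ∪ B, A \ B, B \ A` belong to `F`. -/
def Pliable (F : Set (Set V)) : Prop :=
  ∀ A ∈ F, ∀ B ∈ F, AtLeastTwo (A ∩ B ∈ F) (A ∪ B ∈ F) (A \ B ∈ F) (B \ A ∈ F)

/-- The residual family `F^I`: the members of `F` covered by no edge of `I`. -/
def Residual (F : Set (Set V)) (I : Finset (Sym2 V)) : Set (Set V) := {S ∈ F | d I S = 0}

/-- `A` and `B` cross if `A ∩ B`, `A \ B`, `B \ A` and `V \ (A ∪ B)` are all nonempty. -/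
def Crosses (A B : Set V) : Prop :=
  (A ∩ B).Nonempty ∧ (A \ B).Nonempty ∧ (B \ A).Nonempty ∧ ((A ∪ B)ᶜ : Set V).Nonempty

/-- An `F`-core: an inclusion-minimal member of `F`. -/
def Core (F : Set (Set V)) (C : Set V) : Prop := C ∈ F ∧ ∀ A ∈ F, A ⊆ C → A = C

/-- Property (γ). -/
def PropertyGamma (F : Set (Set V)) : Prop :=
  ∀ (J : Finset (Sym2 V)) (S₁ S₂ C : Set V),
    S₁ ∈ Residual F J → S₂ ∈ Residual F J → S₁ ⊂ S₂ →
    Core (Residual F J) C → Crosses C S₁ → Crosses C S₂ →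
    S₂ \ (S₁ ∪ C) = ∅ ∨ S₂ \ (S₁ ∪ C) ∈ Residual F J

/-- `F` is γ-pliable: pliable and satisfying Property (γ). -/
def GammaPliable (F : Set (Set V)) : Prop := Pliable F ∧ PropertyGamma F

/-- `S` is a witness set for the edge `e ∈ I` if `δ_I(S) = {e}`. -/
def WitnessSet (F : Set (Set V)) (I : Finset (Sym2 V)) (S : Set V) (e : Sym2 V) : Prop :=
  S ∈ F ∧ delta I S = {e}

/-- `L ⊆ F` is a witness family for `I`: `|L| = |I|` and each `e ∈ I` has a witness set in `L`. -/
def WitnessFamily (F : Set (Set V)) (I : Finset (Sym2 V)) (L : Finset (Set V)) : Prop :=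
  ↑L ⊆ F ∧ L.card = I.card ∧ ∀ e ∈ I, ∃ S ∈ L, WitnessSet F I S e

/-- A family is laminar if any two members are disjoint or one contains the other. -/
def Laminar (L : Finset (Set V)) : Prop :=
  ∀ A ∈ L, ∀ B ∈ L, A ⊆ B ∨ B ⊆ A ∨ Disjoint A B

/-- `S ∈ L` owns `C` if `S` is the inclusion-minimal member of `L` containing `C`. -/
def Owns (L : Finset (Set V)) (S C : Set V) : Prop :=
  S ∈ L ∧ C ⊆ S ∧ ∀ T ∈ L, C ⊆ T → S ⊆ T

/-- `S ∈ L` is hollow if it owns no `F`-core. -/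
def Hollow (F : Set (Set V)) (L : Finset (Set V)) (S : Set V) : Prop :=
  S ∈ L ∧ ∀ C : Set V, Core F C → ¬ Owns L S C

/-- `A` is the unique child of `S` in `L`: the unique maximal member of `L`
properly contained in `S`. -/
def UniqueChild (L : Finset (Set V)) (A S : Set V) : Prop :=
  A ∈ L ∧ A ⊂ S ∧ ∀ B ∈ L, B ⊂ S → B ⊆ A

/-- `(S 0, S 1, …, S ℓ)` is a hollow chain in `L`. -/
def HollowChain (F : Set (Set V)) (L : Finset (Set V)) (S : ℕ → Set V) (ℓ : ℕ) : Prop :=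
  (∀ i ≤ ℓ, S i ∈ L) ∧
  (∀ i, 1 ≤ i → i ≤ ℓ → Hollow F L (S i)) ∧
  S ℓ ≠ Set.univ ∧
  (∀ i, 1 ≤ i → i ≤ ℓ → UniqueChild L (S (i - 1)) (S i))

/-- `U`: the union of all `F`-cores. -/
def coreUnion (F : Set (Set V)) : Set V := ⋃₀ {C | Core F C}

/-- `F` is uncrossable. -/
def Uncrossable (F : Set (Set V)) : Prop :=
  ∀ A ∈ F, ∀ B ∈ F, (A ∩ B ∈ F ∧ A ∪ B ∈ F) ∨ (A \ B ∈ F ∧ B \ A ∈ F)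

/-- `F` is semi-uncrossable. -/
def SemiUncrossable (F : Set (Set V)) : Prop :=
  ∀ A ∈ F, ∀ B ∈ F,
    (A ∩ B ∈ F ∧ (A ∪ B ∈ F ∨ A \ B ∈ F ∨ B \ A ∈ F)) ∨ (A \ B ∈ F ∧ B \ A ∈ F)

end SFEC

open SFEC

namespace SFEC

variable {V : Type*}

theorem residual_empty (F : Set (Set V)) : Residual F ∅ = F := by
  ext S
  simp [Residual, d, delta]

theorem exists_core_subset [Finite V] {F : Set (Set V)} {S : Set V} (hS : S ∈ F) :
    ∃ C, Core F C ∧ C ⊆ S := by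
  obtain ⟨C, hCS, hC⟩ := (Set.toFinite F).exists_le_minimal hS
  exact ⟨C, ⟨hC.prop, fun A hA hAC => Set.Subset.antisymm hAC (hC.le_of_le hA hAC)⟩, hCS⟩

/-- Distinct cores of a pliable family are disjoint. -/
theorem Core.eq_of_mem {F : Set (Set V)} (hp : Pliable F)
    {C D : Set V} (hC : Core F C) (hD : Core F D) {x : V} (hxC : x ∈ C) (hxD : x ∈ D) :
    C = D := by
  have h_inter : C ∩ D ∈ F → C = D := fun h =>
    (hC.2 _ h Set.inter_subset_left).symm.trans (hD.2 _ h Set.inter_subset_right)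
  have h_left : C \ D ∉ F := fun h =>
    ((hC.2 _ h Set.sdiff_subset).symm ▸ hxC : x ∈ C \ D).2 hxD
  have h_right : D \ C ∉ F := fun h =>
    ((hD.2 _ h Set.sdiff_subset).symm ▸ hxD : x ∈ D \ C).2 hxC
  have := hp C hC.1 D hD.1
  unfold AtLeastTwo at this
  tauto

theorem Core.crosses {F : Set (Set V)} (hF : IsSetFamily F) (hp : Pliable F)
    {C S : Set V} (hC : Core F C) (hS : S ∈ F) (h_meet : (C ∩ S).Nonempty) (hCS : ¬ C ⊆ S) :
    Crosses C S := by
  obtain ⟨x, hxC, hxS⟩ := h_meet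
  have h_inter : C ∩ S ∉ F := fun h =>
    hCS (Set.inter_eq_left.mp (hC.2 _ h Set.inter_subset_left))
  have h_left : C \ S ∉ F := fun h =>
    ((hC.2 _ h Set.sdiff_subset).symm ▸ hxC : x ∈ C \ S).2 hxS
  have h : C ∪ S ∈ F ∧ S \ C ∈ F := by
    have := hp C hC.1 S hS
    unfold AtLeastTwo at this
    tauto
  refine ⟨⟨x, hxC, hxS⟩, Set.sdiff_nonempty.mpr hCS, ?_, ?_⟩
  · exact Set.nonempty_iff_ne_empty.mpr fun h0 => hF.1 (h0 ▸ h.2)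
  · exact Set.nonempty_compl.mpr fun h0 => hF.2 (h0 ▸ h.1)

/-- If every core inside `S₂` meets `S₁`, a core that meets `S₁` and leaves `S₂` contains
the difference `S₂ \ S₁`. -/
theorem Core.diff_subset [Finite V] {F : Set (Set V)} (hF : IsSetFamily F)
    (hgp : GammaPliable F) {S₁ S₂ C : Set V} (h₁ : S₁ ∈ F) (h₂ : S₂ ∈ F) (h_ss : S₁ ⊂ S₂)
    (hC : Core F C) (h_meet : (C ∩ S₁).Nonempty) (hCS : ¬ C ⊆ S₂)
    (h_core : ∀ D, Core F D → D ⊆ S₂ → (D ∩ S₁).Nonempty) : S₂ \ S₁ ⊆ C := by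
  have h := hgp.2 ∅ S₁ S₂ C
  rw [residual_empty] at h
  have h_meet₂ : (C ∩ S₂).Nonempty := h_meet.mono (Set.inter_subset_inter_right C h_ss.subset)
  rcases h h₁ h₂ h_ss hC
    (hC.crosses hF hgp.1 h₁ h_meet fun h => hCS (h.trans h_ss.subset))
    (hC.crosses hF hgp.1 h₂ h_meet₂ hCS) with h0 | h0
  · rw [Set.sdiff_eq_empty] at h0
    exact fun x hx => (h0 hx.1).resolve_left hx.2
  · obtain ⟨D, hD, hDS⟩ := exists_core_subset h0
    obtain ⟨x, hxD, hx₁⟩ := h_core D hD (hDS.trans Set.sdiff_subset)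
    exact absurd (Or.inl hx₁) (hDS hxD).2

/-- Each member of a witness family is determined by the edge covering it. -/
theorem WitnessFamily.eq_of_delta_eq {F : Set (Set V)} {I : Finset (Sym2 V)}
    {L : Finset (Set V)} (h : WitnessFamily F I L) {S T : Set V} (hS : S ∈ L) (hT : T ∈ L)
    (h_eq : delta I S = delta I T) : S = T := by
  choose! f hfL hf using h.2.2
  have h_inj : Set.InjOn f I := fun e he e' he' hee => by
    have h1 := (hf e he).2
    rw [hee, (hf e' he').2] at h1
    exact (Finset.singleton_injective h1).symm
  have h_image : I.image f = L := by
    refine Finset.eq_of_subset_of_card_le (Finset.image_subset_iff.mpr hfL) ?_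
    rw [Finset.card_image_of_injOn h_inj, h.2.1]
  rw [← h_image, Finset.mem_image] at hS hT
  obtain ⟨e, he, rfl⟩ := hS
  obtain ⟨e', he', rfl⟩ := hT
  rw [(hf e he).2, (hf e' he').2] at h_eq
  rw [Finset.singleton_injective h_eq]

/-- A core inside a hollow set lies in its unique child. -/
theorem Hollow.core_subset_child {F : Set (Set V)} (hF : IsSetFamily F) {L : Finset (Set V)}
    (hlam : Laminar L) {A S C : Set V} (hS : S ∈ L) (h_hollow : Hollow F (insert Set.univ L) S)
    (h_child : UniqueChild (insert Set.univ L) A S) (hC : Core F C) (hCS : C ⊆ S) : C ⊆ A := by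
  have h := h_hollow.2 C hC
  simp only [Owns, not_and, not_forall] at h
  obtain ⟨T, hT, hCT, hST⟩ := h h_hollow.1 hCS
  rcases Finset.mem_insert.mp hT with rfl | hTL
  · exact absurd (Set.subset_univ _) hST
  rcases hlam S hS T hTL with h | h | h
  · exact absurd h hST
  · exact hCT.trans (h_child.2.2 T hT ⟨h, hST⟩)
  · have hC0 : C = ∅ := Set.subset_empty_iff.mp (h hCS hCT)
    exact absurd (hC0 ▸ hC.1) hF.1

theorem HollowChain.ssubset {F : Set (Set V)} {L : Finset (Set V)} {S : ℕ → Set V} {ℓ : ℕ}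
    (h : HollowChain F L S ℓ) {i j : ℕ} (hij : i < j) (hj : j ≤ ℓ) : S i ⊂ S j := by
  induction j, hij using Nat.le_induction with
  | base => exact (h.2.2.2 (i + 1) (by omega) hj).2.1
  | succ j _ ih => exact (ih (by omega)).trans (h.2.2.2 (j + 1) (by omega) hj).2.1

theorem HollowChain.mem {F : Set (Set V)} {L : Finset (Set V)} {S : ℕ → Set V} {ℓ : ℕ}
    (h : HollowChain F (insert Set.univ L) S ℓ) {i : ℕ} (hi : i ≤ ℓ) : S i ∈ L := by
  refine (Finset.mem_insert.mp (h.1 i hi)).resolve_left fun h0 => ?_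
  rcases hi.eq_or_lt with rfl | hlt
  · exact h.2.2.1 h0
  · exact (h.ssubset hlt le_rfl).2 (h0 ▸ Set.subset_univ _)

theorem HollowChain.core_subset {F : Set (Set V)} (hF : IsSetFamily F) {L : Finset (Set V)}
    (hlam : Laminar L) {S : ℕ → Set V} {ℓ : ℕ} (h : HollowChain F (insert Set.univ L) S ℓ)
    {C : Set V} (hC : Core F C) {i : ℕ} (hi : i ≤ ℓ) (hCS : C ⊆ S i) : C ⊆ S 0 := by
  induction i with
  | zero => exact hCS
  | succ i ih =>
    exact ih (by omega) (Hollow.core_subset_child hF hlam (h.mem hi) (h.2.1 _ (by omega) hi)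
      (h.2.2.2 _ (by omega) hi) hC hCS)

/-- A core meeting `S i \ S 0` in a hollow chain contains everything from `S i` up to `S ℓ`. -/
theorem HollowChain.diff_subset_core [Finite V] {F : Set (Set V)} (hF : IsSetFamily F)
    (hgp : GammaPliable F) {L : Finset (Set V)} (hLF : ↑L ⊆ F) (hlam : Laminar L)
    {S : ℕ → Set V} {ℓ : ℕ} (h : HollowChain F (insert Set.univ L) S ℓ)
    {C : Set V} (hC : Core F C) {i : ℕ} (hi : i < ℓ) {x : V} (hxC : x ∈ C) (hxi : x ∈ S i)
    (hx0 : x ∉ S 0) : S ℓ \ S i ⊆ C := by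
  refine hC.diff_subset hF hgp (hLF (h.mem hi.le)) (hLF (h.mem le_rfl)) (h.ssubset hi le_rfl)
    ⟨x, hxC, hxi⟩ (fun hCS => hx0 (h.core_subset hF hlam hC le_rfl hCS hxC)) ?_
  intro D hD hDS
  have hD0 := h.core_subset hF hlam hD le_rfl hDS
  obtain ⟨y, hy⟩ : D.Nonempty := Set.nonempty_iff_ne_empty.mpr fun h0 => hF.1 (h0 ▸ hD.1)
  refine ⟨y, hy, ?_⟩
  rcases Nat.eq_zero_or_pos i with rfl | hpos
  · exact hD0 hy
  · exact (h.ssubset hpos hi.le).subset (hD0 hy)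

/-- An edge covering some core does not have both endpoints in one core. -/
theorem Core.not_both_mem {F : Set (Set V)} (hp : Pliable F)
    {u v : V} (h_cov : ∃ C, Core F C ∧ Covers s(u, v) C)
    {D : Set V} (hD : Core F D) (hu : u ∈ D) (hv : v ∈ D) : False := by
  obtain ⟨C, hC, p, q, h_eq, hp', hq'⟩ := h_cov
  rcases Sym2.eq_iff.mp h_eq with ⟨rfl, rfl⟩ | ⟨rfl, rfl⟩
  · exact hq' (hC.eq_of_mem hp hD hp' hu ▸ hv)
  · exact hq' (hC.eq_of_mem hp hD hp' hv ▸ hu)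

end SFEC

theorem stmt_16
    {V : Type*} [Fintype V]
    (F : Set (Set V)) (hF : IsSetFamily F) (hgp : GammaPliable F)
    (I : Finset (Sym2 V)) (hIe : ∀ e ∈ I, ¬ e.IsDiag)
    (hmin : MinimalCover I F)
    (hcov : ∀ e ∈ I, ∃ C : Set V, Core F C ∧ Covers e C)
    (L : Finset (Set V)) (hWF : WitnessFamily F I L) (hlam : Laminar L)
    (S : ℕ → Set V) (ℓ : ℕ)
    (hchain : HollowChain F (insert Set.univ L) S ℓ)
    (a b : ℕ → V)
    (hedge : ∀ i ≤ ℓ, s(a i, b i) ∈ I ∧ a i ∈ S i ∧ b i ∉ S i ∧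
      delta I (S i) = {s(a i, b i)})
    (hℓ : ℓ = 2 ∨ ℓ = 3) :
    ((Finset.Icc 1 ℓ).filter (fun i => a i ∈ coreUnion F)).card +
      ((Finset.range ℓ).filter (fun i => b i ∈ coreUnion F)).card ≤ 3 := by
  have hI : ∀ i ≤ ℓ, ∀ j ≤ ℓ, i < j → ¬ Covers s(a i, b i) (S j) ∧
      ¬ Covers s(a j, b j) (S i) := by
    intro i hi j hj hij
    have h_ne : s(a i, b i) ≠ s(a j, b j) := fun h_eq =>
      (hchain.ssubset hij hj).ne (hWF.eq_of_delta_eq (hchain.mem hi) (hchain.mem hj)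
        (by rw [(hedge i hi).2.2.2, (hedge j hj).2.2.2, h_eq]))
    constructor <;> intro hc
    · have h_mem : s(a i, b i) ∈ delta I (S j) := Finset.mem_filter.mpr ⟨(hedge i hi).1, hc⟩
      rw [(hedge j hj).2.2.2, Finset.mem_singleton] at h_mem
      exact h_ne h_mem
    · have h_mem : s(a j, b j) ∈ delta I (S i) := Finset.mem_filter.mpr ⟨(hedge j hj).1, hc⟩
      rw [(hedge i hi).2.2.2, Finset.mem_singleton] at h_mem
      exact h_ne h_mem.symm
  have hb : ∀ i j, i < j → j ≤ ℓ → b i ∈ S j := by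
    intro i j hij hj
    by_contra hbj
    exact (hI i (by omega) j hj hij).1 ⟨a i, b i, rfl,
      (hchain.ssubset hij hj).subset (hedge i (by omega)).2.1, hbj⟩
  have ha : ∀ i j, i < j → j ≤ ℓ → a j ∉ S i := by
    intro i j hij hj haj
    exact (hI i (by omega) j hj hij).2 ⟨a j, b j, rfl, haj, fun hbj =>
      (hedge j hj).2.2.1 ((hchain.ssubset hij hj).subset hbj)⟩
  have h_excl : ∀ C, Core F C → ∀ i, 1 ≤ i → i < ℓ → a i ∈ C → b i ∈ C → False :=
    fun C hC i _ hi hai hbi =>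
      Core.not_both_mem hgp.1 (hcov _ (hedge i hi.le).1) hC hai hbi
  have h_absorb : ∀ C, Core F C → ∀ i < ℓ, ∀ x ∈ C, x ∈ S i → x ∉ S 0 → S ℓ \ S i ⊆ C :=
    fun C hC i hi x => hchain.diff_subset_core hF hgp hWF.1 hlam hC hi
  have h_pair : ∀ i, 1 ≤ i → i < ℓ → a i ∈ coreUnion F → b i ∉ coreUnion F := by
    rintro i h1 hi ⟨C, hC, haC⟩ -
    exact h_excl C hC i h1 hi haC (h_absorb C hC i hi _ haC (hedge i hi.le).2.1
      (ha 0 i h1 hi.le) ⟨hb i ℓ hi le_rfl, (hedge i hi.le).2.2.1⟩)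
  have h_low : ∀ x, x ∈ S 1 → x ∉ S 0 → 2 < ℓ → x ∉ coreUnion F := by
    rintro x hx1 hx0 h2 ⟨C, hC, hxC⟩
    have h_sub := h_absorb C hC 1 (by omega) x hxC hx1 hx0
    have hb2 : b 2 ∉ S 1 := fun h =>
      (hedge 2 h2.le).2.2.1 ((hchain.ssubset one_lt_two h2.le).subset h)
    exact h_excl C hC 2 (by omega) h2
      (h_sub ⟨(hchain.ssubset h2 le_rfl).subset (hedge 2 h2.le).2.1, ha 1 2 one_lt_two h2.le⟩)
      (h_sub ⟨hb 2 ℓ h2 le_rfl, hb2⟩)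
  rw [Finset.card_filter, Finset.card_filter]
  rcases hℓ with rfl | rfl
  · have h1 := h_pair 1 le_rfl (by omega)
    rw [show Finset.Icc 1 2 = {1, 2} from rfl, Finset.sum_pair (by omega),
      Finset.sum_range_succ, Finset.sum_range_one]
    split_ifs <;> first | omega | exact absurd ‹b 1 ∈ coreUnion F› (h1 ‹_›)
  · have h2 := h_pair 2 (by omega) (by omega)
    have ha1 := h_low (a 1) (hedge 1 (by omega)).2.1 (ha 0 1 (by omega) (by omega)) (by omega)
    have hb0 := h_low (b 0) (hb 0 1 (by omega) (by omega)) (hedge 0 (by omega)).2.2.1 (by omega)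
    rw [show Finset.Icc 1 3 = {1, 2, 3} from rfl, Finset.sum_insert (by simp),
      Finset.sum_pair (by omega), Finset.sum_range_succ, Finset.sum_range_succ,
      Finset.sum_range_one, if_neg ha1, if_neg hb0]
    split_ifs <;> first | omega | exact absurd ‹b 2 ∈ coreUnion F› (h2 ‹_›)
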